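/- Let n ≥ 2 be an integer, p ∈ {1,…,n−1} with gcd(n,p) = 1, and q ∈ {1,…,n−1} with pq ≡ 1 (mod n), and let Ω = B − C. For every θ ∈ ℝ^{n−1}, with θ_0 = θ_n = 0, ρ(θ)_ℓ = exp(i(θ_{ℓ−1} − θ_ℓ)), Δ_j(θ) = exp(i Σ_{k=1}^{n−1} Ω_{j,k} θ_k) for j = 1,…,n−1 and Δ_n(θ) = 1, the following recursion holds: Δ_j(θ) = Δ_{j+p}(θ)·ρ(θ)_{j+p} for 1 ≤ j ≤ n−p, and Δ_j(θ) = Δ_{j+p−n}(θ)·ρ(θ)_{j+p−n} for n−p < j ≤ n. -/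

import Mathlib

open Finset Matrix
open scoped BigOperators Real

noncomputable section

/-- Entries of the `(n-1) × (n-1)` integer matrix `A` (1-based indices):
`A_{j,k} = 1` if `1 ≤ j ≤ n-p` and `j ≤ k < j+p`, `A_{j,k} = -1` if
`n-p < j ≤ n-1` and `j+p-n ≤ k < j`, and `0` otherwise. -/
def Aent (n p : ℕ) (j k : ℕ) : ℤ :=
  if j ≤ n - p ∧ j ≤ k ∧ k < j + p then 1
  else if n - p < j ∧ j + p ≤ k + n ∧ k < j then -1
  else 0

open Classical in
/-- Entries of the binary matrix `B`: `B_{m,k} = 0` iff `k - m ≡ ℓ p (mod n)`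
for some `ℓ ∈ {1, …, n-q}`, else `1`. -/
def Bent (n p q : ℕ) (m k : ℕ) : ℤ :=
  if ∃ ℓ ∈ Finset.Icc 1 (n - q), ((k : ℤ) - (m : ℤ)) ≡ ((ℓ * p : ℕ) : ℤ) [ZMOD (n : ℤ)]
  then 0 else 1

open Classical in
/-- Entries of the binary matrix `C`: `C_{m,k} = 0` iff `k ≡ ℓ p (mod n)`
for some `ℓ ∈ {1, …, n-q}`, else `1`. -/
def Cent (n p q : ℕ) (m k : ℕ) : ℤ :=
  if ∃ ℓ ∈ Finset.Icc 1 (n - q), ((k : ℤ)) ≡ ((ℓ * p : ℕ) : ℤ) [ZMOD (n : ℤ)]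
  then 0 else 1

/-- Entries of `Ω = B - C`. -/
def Ωent (n p q : ℕ) (m k : ℕ) : ℤ := Bent n p q m k - Cent n p q m k

/-- The matrix `A` as an `(n-1) × (n-1)` integer matrix. -/
def Amat (n p : ℕ) : Matrix (Fin (n - 1)) (Fin (n - 1)) ℤ :=
  fun j k => Aent n p (j.1 + 1) (k.1 + 1)

/-- The matrix `Ω = B - C` as an `(n-1) × (n-1)` integer matrix. -/
def Ωmat (n p q : ℕ) : Matrix (Fin (n - 1)) (Fin (n - 1)) ℤ :=
  fun j k => Ωent n p q (j.1 + 1) (k.1 + 1)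

/-- Cyclic window sum `ξ_ℓ + ξ_{ℓ+1} + ⋯ + ξ_{ℓ+d-1}`. -/
def wsum (ξ : ℕ → ℝ) (ℓ d : ℕ) : ℝ := ∑ m ∈ Finset.range d, ξ (ℓ + m)

/-- First type (i) interval: `(p/n - 1/(nq))π < y < pπ/n` (so `M = pπ - ny > 0`). -/
def typeI1 (n p q : ℕ) (y : ℝ) : Prop :=
  ((p : ℝ) / n - 1 / ((n : ℝ) * q)) * Real.pi < y ∧ y < (p : ℝ) * Real.pi / n

/-- Second type (i) interval: `pπ/n < y < (p/n + 1/(n(n-q)))π` (so `M = pπ - ny < 0`). -/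
def typeI2 (n p q : ℕ) (y : ℝ) : Prop :=
  (p : ℝ) * Real.pi / n < y ∧ y < ((p : ℝ) / n + 1 / ((n : ℝ) * ((n : ℝ) - q))) * Real.pi

/-- `M = pπ - ny`. -/
def Mval (n p : ℕ) (y : ℝ) : ℝ := (p : ℝ) * Real.pi - (n : ℝ) * y

/-- Membership of `ξ` (a cyclic sequence of reals, indices `1, …, n`) in the open
domain `A_y^+`: cyclic convention `ξ_{m+n} = ξ_m`, positivity, total sum `π`, and
`sgn(M)(ξ_j + ⋯ + ξ_{j+p-1} - y) > 0` for `j = 1, …, n`. -/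
def inAy (n p : ℕ) (y : ℝ) (ξ : ℕ → ℝ) : Prop :=
  (∀ m, ξ (m + n) = ξ m) ∧
  (∀ k, 1 ≤ k → k ≤ n → 0 < ξ k) ∧
  (∑ k ∈ Finset.Icc 1 n, ξ k = Real.pi) ∧
  (∀ j, 1 ≤ j → j ≤ n → 0 < Real.sign (Mval n p y) * (wsum ξ j p - y))

/-- `|u_j(ξ)|² = sgn(M) (ξ_j + ⋯ + ξ_{j+p-1} - y)`. -/
def usq (n p : ℕ) (y : ℝ) (ξ : ℕ → ℝ) (j : ℕ) : ℝ :=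
  Real.sign (Mval n p y) * (wsum ξ j p - y)

/-- `z_ℓ(ξ, w) = sgn(sin(ny)) ∏_{d=1}^{n-1} sin(ξ_ℓ + ⋯ + ξ_{ℓ+d-1} - w)/sin(ξ_ℓ + ⋯ + ξ_{ℓ+d-1})`;
the paper's `z_ℓ(ξ, ±y)` is obtained at `w = ±y`. -/
def zfun (n : ℕ) (y : ℝ) (ξ : ℕ → ℝ) (w : ℝ) (ℓ : ℕ) : ℝ :=
  Real.sign (Real.sin ((n : ℝ) * y)) *
    ∏ d ∈ Finset.Icc 1 (n - 1), Real.sin (wsum ξ ℓ d - w) / Real.sin (wsum ξ ℓ d)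

/-- `x_j - x_ℓ` expressed through `ξ`: `ξ_ℓ + ⋯ + ξ_{j-1}` for `ℓ ≤ j`, antisymmetric. -/
def xdiff (ξ : ℕ → ℝ) (j ℓ : ℕ) : ℝ :=
  if ℓ ≤ j then wsum ξ ℓ (j - ℓ) else -(wsum ξ j (ℓ - j))

/-- `ρ(θ)_ℓ = exp(i(θ_{ℓ-1} - θ_ℓ))` (with the conventions `θ_0 = θ_n = 0` imposed
as hypotheses on `θ`). -/
def ρfun (θ : ℕ → ℝ) (ℓ : ℕ) : ℂ :=
  Complex.exp (Complex.I * ((θ (ℓ - 1) - θ ℓ : ℝ) : ℂ))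

/-- `Δ_j(θ) = exp(i Σ_{k=1}^{n-1} Ω_{j,k} θ_k)` for `1 ≤ j ≤ n-1`, and `Δ_n(θ) = 1`. -/
def Δfun (n p q : ℕ) (θ : ℕ → ℝ) (j : ℕ) : ℂ :=
  if j = n then 1
  else Complex.exp (Complex.I *
    ((∑ k ∈ Finset.Icc 1 (n - 1), (Ωent n p q j k : ℝ) * θ k : ℝ) : ℂ))

/-- The local trigonometric Lax matrix
`L(ξ,θ)_{j,ℓ} = [sin y / sin(x_j - x_ℓ + y)] v_j(ξ,y) v_ℓ(ξ,-y) ρ(θ)_ℓ`. -/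
def Lloc (n : ℕ) (y : ℝ) (ξ θ : ℕ → ℝ) (j ℓ : ℕ) : ℂ :=
  ((Real.sin y / Real.sin (xdiff ξ j ℓ + y) : ℝ) : ℂ) *
    ((Real.sqrt (zfun n y ξ y j) : ℝ) : ℂ) *
    ((Real.sqrt (zfun n y ξ (-y) ℓ) : ℝ) : ℂ) * ρfun θ ℓ

/-- The embedding map `ℰ(ξ,θ)_j = |u_j(ξ)| Δ_j(θ)^{sgn M}` for `j = 1, …, n-1`
and `ℰ(ξ,θ)_n = |u_n(ξ)|` (note `Δ_n = 1`). -/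
def Emap (n p q : ℕ) (y : ℝ) (ξ θ : ℕ → ℝ) (j : ℕ) : ℂ :=
  ((Real.sqrt (usq n p y ξ j) : ℝ) : ℂ) *
    Δfun n p q θ j ^ (if 0 < Mval n p y then (1 : ℤ) else -1)

/-- `σ(ℓ) = ℓ + n - p` if `1 ≤ ℓ ≤ p`, and `σ(ℓ) = ℓ - p` if `p < ℓ ≤ n`. -/
def σmap (n p : ℕ) (ℓ : ℕ) : ℕ := if ℓ ≤ p then ℓ + n - p else ℓ - p

/-- The Weierstrass-type function
`ws_b(z) = sin z ∏_{m=1}^∞ (1 + sin² z / sinh²(2 m b))` with `ω = π/2`, `ω' = i b`. -/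
def wsb (b : ℝ) (z : ℂ) : ℂ :=
  Complex.sin z *
    ∏' m : ℕ, (1 + Complex.sin z ^ 2 / Complex.sinh (2 * ((m : ℂ) + 1) * (b : ℂ)) ^ 2)

/-- Elliptic analogue of `zfun`, built from `ws_b` instead of `sin`. -/
def zbfun (b : ℝ) (n : ℕ) (y : ℝ) (ξ : ℕ → ℝ) (w : ℝ) (ℓ : ℕ) : ℝ :=
  Real.sign ((wsb b (((n : ℝ) * y : ℝ) : ℂ)).re) *
    ∏ d ∈ Finset.Icc 1 (n - 1),
      (wsb b ((wsum ξ ℓ d - w : ℝ) : ℂ)).re / (wsb b ((wsum ξ ℓ d : ℝ) : ℂ)).re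

/-- The local elliptic Lax matrix with spectral parameter `lam`. -/
def Lbloc (b : ℝ) (n : ℕ) (y : ℝ) (lam : ℂ) (ξ θ : ℕ → ℝ) (j ℓ : ℕ) : ℂ :=
  (wsb b ((y : ℝ) : ℂ) / wsb b lam) *
    (wsb b (((xdiff ξ j ℓ : ℝ) : ℂ) + lam) / wsb b ((xdiff ξ j ℓ + y : ℝ) : ℂ)) *
    ((Real.sqrt (zbfun b n y ξ y j) : ℝ) : ℂ) *
    ((Real.sqrt (zbfun b n y ξ (-y) ℓ) : ℝ) : ℂ) * ρfun θ ℓ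

/-- The subset `S = {ℓ p mod n : ℓ = 1, …, n-q}` of `ℤ/nℤ`. -/
def Sset (n p q : ℕ) : Finset (ZMod n) :=
  (Finset.Icc 1 (n - q)).image (fun ℓ => ((ℓ * p : ℕ) : ZMod n))

/-- The subset `S_i = {i + ℓ mod n : ℓ = 0, …, p-1}` of `ℤ/nℤ`. -/
def Siset (n p : ℕ) (i : ZMod n) : Finset (ZMod n) :=
  (Finset.range p).image (fun ℓ : ℕ => i + (ℓ : ZMod n))

/-- `I_i = |S_i ∩ S|`. -/
def Inum (n p q : ℕ) (i : ZMod n) : ℕ := (Siset n p i ∩ Sset n p q).card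

/-- The function `W_j(ξ)` of Statement 13. -/
def Wfun (n p : ℕ) (y : ℝ) (ξ : ℕ → ℝ) (j : ℕ) : ℝ :=
  (Real.sin (usq n p y ξ j) / usq n p y ξ j) *
    ((-1 : ℝ) ^ (p - 1) / Real.sin (wsum ξ j p)) *
    ∏ d ∈ (Finset.Icc 1 (n - 1)).erase p,
      Real.sin (wsum ξ j d - y) / Real.sin (wsum ξ j d)

/-- Since `q` inverts `p` modulo `n`, the residues `ℓ p` with `1 ≤ ℓ ≤ n - q` are those `x`
for which the residue of `x q` lies in `[1, n - q]`. -/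
lemma exists_modEq_mul_iff {n p q : ℕ} (hq : 1 ≤ q) (hqn : q < n) (hpq : p * q ≡ 1 [MOD n])
    (x : ℤ) :
    (∃ ℓ ∈ Finset.Icc 1 (n - q), x ≡ ((ℓ * p : ℕ) : ℤ) [ZMOD (n : ℤ)]) ↔
      1 ≤ (x * q) % n ∧ (x * q) % n + q ≤ n := by
  have h : (p : ℤ) * q ≡ 1 [ZMOD n] := by exact_mod_cast Int.natCast_modEq_iff.mpr hpq
  have hn : (0 : ℤ) < n := by omega
  constructor
  · rintro ⟨ℓ, hℓ, hx⟩
    rw [Finset.mem_Icc] at hℓ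
    have h1 : x * q ≡ ℓ [ZMOD n] := by
      calc x * q ≡ ((ℓ * p : ℕ) : ℤ) * q [ZMOD n] := hx.mul_right _
        _ = ℓ * (p * q) := by push_cast; ring
        _ ≡ ℓ * 1 [ZMOD n] := h.mul_left _
        _ = ℓ := mul_one _
    have h2 : x * q % n = ℓ := by
      rw [h1.eq, Int.emod_eq_of_lt] <;> omega
    omega
  · rintro ⟨h1, h2⟩
    refine ⟨((x * q) % n).toNat, Finset.mem_Icc.mpr (by omega), ?_⟩
    push_cast
    rw [Int.toNat_of_nonneg (by omega)]
    calc x = x * 1 := (mul_one _).symm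
      _ ≡ x * (p * q) [ZMOD n] := (h.mul_left _).symm
      _ = x * q * p := by ring
      _ ≡ x * q % n * p [ZMOD n] := (Int.mod_modEq _ _).symm.mul_right _

/-- Multiplication by `q` is injective modulo `n`. -/
lemma modEq_iff_mul_emod_eq {n p q : ℕ} (hpq : p * q ≡ 1 [MOD n]) (x y : ℤ) :
    x ≡ y [ZMOD n] ↔ x * q % n = y * q % n := by
  have h : (p : ℤ) * q ≡ 1 [ZMOD n] := by exact_mod_cast Int.natCast_modEq_iff.mpr hpq
  refine ⟨fun hxy => hxy.mul_right _, fun hxy => ?_⟩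
  calc x = x * 1 := (mul_one _).symm
    _ ≡ x * (p * q) [ZMOD n] := (h.mul_left _).symm
    _ = x * q * p := by ring
    _ ≡ y * q * p [ZMOD n] := Int.ModEq.mul_right _ hxy
    _ = y * (p * q) := by ring
    _ ≡ y * 1 [ZMOD n] := h.mul_left _
    _ = y := mul_one _

/-- Row `n` of `Ω`, extended by the same formula, vanishes. -/
lemma Ωent_self (n p q k : ℕ) : Ωent n p q n k = 0 := by
  have h : ∀ a : ℤ, (k : ℤ) - n ≡ a [ZMOD n] ↔ (k : ℤ) ≡ a [ZMOD n] := fun a => by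
    simp [Int.ModEq]
  simp only [Ωent, Bent, Cent, h, sub_self]

/-- Consecutive rows of `Ω` along the shift by `p` differ in at most the two columns
`m - 1` and `m`. -/
lemma Ωent_sub_Ωent {n p q : ℕ} (hq : 1 ≤ q) (hqn : q < n) (hpq : p * q ≡ 1 [MOD n])
    {j m k : ℕ} (hm1 : 1 ≤ m) (hmn : m ≤ n) (hk1 : 1 ≤ k) (hkn : k < n)
    (hjm : (m : ℤ) ≡ j + p [ZMOD n]) :
    Ωent n p q j k - Ωent n p q m k =
      (if k = m - 1 then 1 else 0) - (if k = m then 1 else 0) := by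
  have h : (p : ℤ) * q ≡ 1 [ZMOD n] := by exact_mod_cast Int.natCast_modEq_iff.mpr hpq
  have hn : (0 : ℤ) < n := by omega
  have small : ∀ a : ℤ, -n < a → a < n → (a ≡ 0 [ZMOD n] ↔ a = 0) := fun a h1 h2 =>
    ⟨fun ha => Int.eq_zero_of_abs_lt_dvd (Int.modEq_zero_iff_dvd.mp ha) (abs_lt.mpr ⟨h1, h2⟩),
      fun ha => by rw [ha]⟩
  have hkm : k = m ↔ ((k : ℤ) - m) * q % n = 0 := by
    rw [← Int.zero_emod n, ← zero_mul (q : ℤ), ← modEq_iff_mul_emod_eq hpq,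
      small _ (by omega) (by omega)]
    omega
  have hneg : (-1 : ℤ) * q % n = n - q := by
    rw [← Int.add_emod_right, Int.emod_eq_of_lt] <;> omega
  have hkm' : k = m - 1 ↔ ((k : ℤ) - m) * q % n = n - q := by
    rw [← hneg, ← modEq_iff_mul_emod_eq hpq]
    have : ((k : ℤ) - m ≡ -1 [ZMOD n]) ↔ ((k : ℤ) - m + 1 ≡ 0 [ZMOD n]) :=
      ⟨fun h => h.add_right 1, fun h => Int.ModEq.add_right_cancel' 1 h⟩
    rw [this, small _ (by omega) (by omega)]
    omega
  have hr : ((k : ℤ) - j) * q % n = (((k : ℤ) - m) * q % n + 1) % n := by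
    rw [Int.emod_add_emod]
    calc ((k : ℤ) - j) * q ≡ (k - m + p) * q [ZMOD n] := by
          refine Int.ModEq.mul_right _ ?_
          have h3 := (Int.ModEq.refl ((k : ℤ) - j - m)).add hjm
          convert h3 using 1 <;> ring
      _ = (k - m) * q + p * q := by ring
      _ ≡ (k - m) * q + 1 [ZMOD n] := h.add_left _
  have hC : Cent n p q j k = Cent n p q m k := rfl
  simp only [Ωent, hC, sub_sub_sub_cancel_right, Bent, exists_modEq_mul_iff hq hqn hpq, hkm, hkm', hr]
  have h0 := Int.emod_nonneg (((k : ℤ) - m) * q) hn.ne'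
  have h1 := Int.emod_lt_of_pos (((k : ℤ) - m) * q) hn
  generalize ((k : ℤ) - m) * q % n = r at h0 h1 ⊢
  rcases eq_or_ne (r + 1) n with hrn | hrn
  · rw [hrn, Int.emod_self]
    split_ifs <;> omega
  · rw [Int.emod_eq_of_lt (a := r + 1) (by omega) (by omega)]
    split_ifs <;> omega

/-- The exponential formula for `Δ_j` also holds at `j = n`. -/
lemma Δfun_eq_exp (n p q : ℕ) (θ : ℕ → ℝ) (j : ℕ) :
    Δfun n p q θ j = Complex.exp (Complex.I *
      ((∑ k ∈ Finset.Icc 1 (n - 1), (Ωent n p q j k : ℝ) * θ k : ℝ) : ℂ)) := by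
  unfold Δfun
  split_ifs with h
  · subst h
    simp [Ωent_self]
  · rfl

/-- Both branches of the recursion, stated for any `m ∈ {1, …, n}` congruent to `j + p`. -/
lemma Δfun_eq_mul_ρfun {n p q : ℕ} (hq : 1 ≤ q) (hqn : q < n) (hpq : p * q ≡ 1 [MOD n])
    {θ : ℕ → ℝ} (hθ0 : θ 0 = 0) (hθn : θ n = 0)
    {j m : ℕ} (hm1 : 1 ≤ m) (hmn : m ≤ n) (hjm : (m : ℤ) ≡ j + p [ZMOD n]) :
    Δfun n p q θ j = Δfun n p q θ m * ρfun θ m := by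
  have hsum : ∑ k ∈ Finset.Icc 1 (n - 1), (Ωent n p q j k : ℝ) * θ k =
      ∑ k ∈ Finset.Icc 1 (n - 1), (Ωent n p q m k : ℝ) * θ k + (θ (m - 1) - θ m) := by
    rw [← sub_eq_iff_eq_add', ← Finset.sum_sub_distrib]
    calc _ = ∑ k ∈ Finset.Icc 1 (n - 1),
          ((if k = m - 1 then θ k else 0) - (if k = m then θ k else 0)) := by
          refine Finset.sum_congr rfl fun k hk => ?_
          rw [Finset.mem_Icc] at hk
          have hΩ := Ωent_sub_Ωent hq hqn hpq hm1 hmn hk.1 (by omega) hjm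
          rw [← sub_mul, ← Int.cast_sub, hΩ]
          push_cast
          rw [sub_mul, ite_mul, ite_mul, one_mul, zero_mul]
      _ = θ (m - 1) - θ m := by
          rw [Finset.sum_sub_distrib, Finset.sum_ite_eq', Finset.sum_ite_eq']
          congr 1
          · split_ifs with h
            · rfl
            · rw [Finset.mem_Icc] at h
              rw [show m - 1 = 0 by omega, hθ0]
          · split_ifs with h
            · rfl
            · rw [Finset.mem_Icc] at h
              rw [show m = n by omega, hθn]
  rw [Δfun_eq_exp, Δfun_eq_exp, ρfun, ← Complex.exp_add, ← mul_add, ← Complex.ofReal_add, hsum]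

/-- The recursion `Δ_j(θ) = Δ_{j+p}(θ) ρ(θ)_{j+p}` for `1 ≤ j ≤ n-p`
and `Δ_j(θ) = Δ_{j+p-n}(θ) ρ(θ)_{j+p-n}` for `n-p < j ≤ n`. -/
theorem stmt5 (n p q : ℕ) (hn : 2 ≤ n) (hp1 : 1 ≤ p) (hpn : p ≤ n - 1)
    (hgcd : Nat.gcd n p = 1) (hq1 : 1 ≤ q) (hqn : q ≤ n - 1)
    (hpq : p * q ≡ 1 [MOD n])
    (θ : ℕ → ℝ) (hθ0 : θ 0 = 0) (hθn : θ n = 0) :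
    (∀ j, 1 ≤ j → j ≤ n - p →
      Δfun n p q θ j = Δfun n p q θ (j + p) * ρfun θ (j + p)) ∧
    (∀ j, n - p < j → j ≤ n →
      Δfun n p q θ j = Δfun n p q θ (j + p - n) * ρfun θ (j + p - n)) := by
  refine ⟨fun j _ hj => Δfun_eq_mul_ρfun hq1 (by omega) hpq hθ0 hθn (by omega) (by omega) ?_,
    fun j hj hjn => Δfun_eq_mul_ρfun hq1 (by omega) hpq hθ0 hθn (by omega) (by omega) ?_⟩
  · push_cast
    rfl
  · rw [Nat.cast_sub (by omega)]
    push_cast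
    simp [Int.ModEq]

end
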